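/- Let τ = ℕ → ℕ with 0_τ the constant-zero function, and let g, h : (ℕ → (ℕ → ℕ)) → ℕ. Suppose S_x is a bar securing g and S_y is a bar securing h. Define S s := S_x s ∧ S_y s ∧ max (g ŝ) (h ŝ) < |s|. Then S is a bar and S secures the functional fun α => α (g α) (h α). (Securing step of the α-case for τ = ℕ → ℕ, Section 3.4.) -/

import Mathlib

/-- Extension of a finite sequence `s` by infinitely many copies of `z` (the "hat"). -/
def ext {τ : Type*} (z : τ) (s : List τ) : ℕ → τ := fun n => s.getD n z

/-- Concatenation `s * β` of a finite sequence with an infinite one. -/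
def cat {τ : Type*} (s : List τ) (β : ℕ → τ) : ℕ → τ :=
  fun n => if h : n < s.length then s[n] else β (n - s.length)

/-- `S` is a bar: decidable, monotone, and hit by every infinite sequence. -/
def IsBar {τ : Type*} (S : List τ → Prop) : Prop :=
  (∀ s, S s ∨ ¬ S s) ∧ (∀ s t : List τ, S s → S (s ++ t)) ∧
    (∀ α : ℕ → τ, ∃ n : ℕ, S ((List.range n).map α))

/-- `S` secures `Y`: whenever `S s` holds, `fun β => Y (s * β)` is constant. -/
def Secures {τ : Type*} (S : List τ → Prop) (Y : (ℕ → τ) → ℕ) : Prop :=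
  ∀ s, S s → ∀ β β' : ℕ → τ, Y (cat s β) = Y (cat s β')

/-- The general bar-recursion equation for the bar `S`. -/
def GenBR {τ σ : Type*} (S : List τ → Prop)
    (Δ : (List τ → σ) → (List τ → (τ → σ) → σ) → List τ → σ) : Prop :=
  ∀ G H s, (S s → Δ G H s = G s) ∧
    (¬ S s → Δ G H s = H s (fun x => Δ G H (s ++ [x])))

/-- Spector's bar-recursion equation for the stopping functional `Y`. -/
def SpectorBR {τ σ : Type*} (z : τ) (Y : (ℕ → τ) → ℕ)
    (ξ : (List τ → σ) → (List τ → (τ → σ) → σ) → List τ → σ) : Prop :=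
  ∀ G H s, (Y (ext z s) < s.length → ξ G H s = G s) ∧
    (s.length ≤ Y (ext z s) → ξ G H s = H s (fun x => ξ G H (s ++ [x])))

/-- The auxiliary functional `φ`. -/
def phi {τ σ : Type*} (G : List τ → σ) (H : List τ → (τ → σ) → σ) : ℕ → List τ → σ
  | 0 => G
  | n + 1 => fun s => H s (fun x => phi G H n (s ++ [x]))

/-- The functional `Ψ`, bar recursion for a constant stopping functional. -/
def psi {τ σ : Type*} (k : ℕ) (G : List τ → σ) (H : List τ → (τ → σ) → σ)
    (s : List τ) : σ :=
  if s.length > k then G s else phi G H (k + 1 - s.length) s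

theorem cat_const {τ : Type*} (z : τ) (s : List τ) : cat s (fun _ => z) = ext z s := by
  funext n
  by_cases hn : n < s.length <;> simp [cat, ext, List.getD, hn]

theorem cat_append {τ : Type*} (s t : List τ) (β : ℕ → τ) :
    cat (s ++ t) β = cat s (cat t β) := by
  funext n
  simp only [cat, List.length_append, List.getElem_append]
  split_ifs <;> first | rfl | omega | (congr 1; omega)

theorem Secures.apply_cat {τ : Type*} {S : List τ → Prop} {Y : (ℕ → τ) → ℕ}
    (hY : Secures S Y) (z : τ) {s : List τ} (hs : S s) (β : ℕ → τ) :
    Y (cat s β) = Y (ext z s) := by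
  rw [← cat_const]
  exact hY s hs _ _

theorem Secures.apply_ext_append {τ : Type*} {S : List τ → Prop} {Y : (ℕ → τ) → ℕ}
    (hY : Secures S Y) (z : τ) {s : List τ} (hs : S s) (t : List τ) :
    Y (ext z (s ++ t)) = Y (ext z s) := by
  rw [← cat_const, cat_append, hY.apply_cat z hs]

theorem IsBar.apply_of_le {τ : Type*} {S : List τ → Prop} (hS : IsBar S) (α : ℕ → τ)
    {m n : ℕ} (hmn : m ≤ n) (hm : S ((List.range m).map α)) :
    S ((List.range n).map α) := by
  obtain ⟨k, rfl⟩ := Nat.exists_eq_add_of_le hmn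
  rw [List.range_add, List.map_append]
  exact hS.2.1 _ _ hm

/-- Securing step of the `α`-case for `τ = ℕ → ℕ` (Section 3.4), with `0_τ` the
constant-zero function: if `S_x` is a bar securing `g` and `S_y` a bar securing `h`,
then `S s := S_x s ∧ S_y s ∧ max (g ŝ) (h ŝ) < |s|` is a bar securing
`fun α => α (g α) (h α)`. -/
theorem alpha_case_bar_fn (g h : (ℕ → (ℕ → ℕ)) → ℕ)
    (Sx Sy : List (ℕ → ℕ) → Prop)
    (hbarx : IsBar Sx) (hsecx : Secures Sx g)
    (hbary : IsBar Sy) (hsecy : Secures Sy h) :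
    IsBar (fun s : List (ℕ → ℕ) =>
        Sx s ∧ Sy s ∧ max (g (ext (fun _ => 0) s)) (h (ext (fun _ => 0) s)) < s.length) ∧
    Secures (fun s : List (ℕ → ℕ) =>
        Sx s ∧ Sy s ∧ max (g (ext (fun _ => 0) s)) (h (ext (fun _ => 0) s)) < s.length)
      (fun α : ℕ → (ℕ → ℕ) => α (g α) (h α)) := by
  refine ⟨⟨fun s => Classical.em _, ?_, fun α => ?_⟩, ?_⟩
  · rintro s t ⟨hx, hy, hlt⟩
    refine ⟨hbarx.2.1 s t hx, hbary.2.1 s t hy, ?_⟩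
    rw [hsecx.apply_ext_append _ hx, hsecy.apply_ext_append _ hy, List.length_append]
    omega
  · obtain ⟨m, hm⟩ := hbarx.2.2 α
    obtain ⟨n, hn⟩ := hbary.2.2 α
    have hx := hbarx.apply_of_le α (le_max_left m n) hm
    have hy := hbary.apply_of_le α (le_max_right m n) hn
    set s := (List.range (max m n)).map α with hs
    refine ⟨max m n + (max (g (ext (fun _ => 0) s)) (h (ext (fun _ => 0) s)) + 1), ?_⟩
    rw [List.range_add, List.map_append, ← hs]
    refine ⟨hbarx.2.1 _ _ hx, hbary.2.1 _ _ hy, ?_⟩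
    rw [hsecx.apply_ext_append _ hx, hsecy.apply_ext_append _ hy]
    simp only [List.length_append, List.length_map, List.length_range]
    omega
  · rintro s ⟨hx, hy, hlt⟩ β β'
    have hg : g (ext (fun _ => 0) s) < s.length := (le_max_left _ _).trans_lt hlt
    simp only [hsecx.apply_cat (fun _ => 0) hx, hsecy.apply_cat (fun _ => 0) hy, cat, hg,
      dif_pos]
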